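/- Under the strong convexity, Lipschitz-gradient, and smoothness-bound assumptions, let the sequence (x_k) be generated by Algorithm 3 with sampling period δ > 0, threshold ε > 0, and stepsize α satisfying 0 < α ≤ 1/(2M). Then for every k ≥ 0, f(x_k, t_k) − f*(t_k) ≤ (1 − 2καm)^k (f(x₀, t₀) − f*(t₀)) + (1 − (1 − 2καm)^k) E₃, where κ = 1 − αM/2, E₃ = ψ/(4κ²α²m) + max(γδ², μδ, ηδ²)/(4κ²α²m²), ψ = δ(K₁ + (δ/2)K₃) + (K₂²δ²/(2m))((Mδ/m) + 2), γ = 2K₁/δ + (M/(2ε²))K₁² + (1/2)K₃ + (1/ε)K₁K₂, μ = K₁ + (δ/2)K₃, and η = 2K₁/δ + (1/2)K₃ + (2/ε)K₁K₂ + (M/(2ε²))K₁². -/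

import Mathlib

open scoped RealInnerProductSpace

noncomputable def gradX {n : ℕ} (f : EuclideanSpace ℝ (Fin n) → ℝ → ℝ)
    (x : EuclideanSpace ℝ (Fin n)) (t : ℝ) : EuclideanSpace ℝ (Fin n) :=
  gradient (fun y => f y t) x

noncomputable def gradT {n : ℕ} (f : EuclideanSpace ℝ (Fin n) → ℝ → ℝ)
    (x : EuclideanSpace ℝ (Fin n)) (t : ℝ) : ℝ :=
  deriv (fun s => f x s) t

noncomputable def gradXT {n : ℕ} (f : EuclideanSpace ℝ (Fin n) → ℝ → ℝ)
    (x : EuclideanSpace ℝ (Fin n)) (t : ℝ) : EuclideanSpace ℝ (Fin n) :=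
  gradient (fun y => deriv (fun s => f y s) t) x

noncomputable def gradTT {n : ℕ} (f : EuclideanSpace ℝ (Fin n) → ℝ → ℝ)
    (x : EuclideanSpace ℝ (Fin n)) (t : ℝ) : ℝ :=
  deriv (fun s => deriv (fun r => f x r) s) t

/-- A one-sided Lipschitz condition on the gradient gives a quadratic upper bound. -/
theorem le_quadratic_of_inner_gradient_sub_le {E : Type*} [NormedAddCommGroup E]
    [InnerProductSpace ℝ E] [CompleteSpace E] {F : E → ℝ} (hF : Differentiable ℝ F) (L : ℝ)
    (hL : ∀ x z : E, ⟪z - x, gradient F z - gradient F x⟫ ≤ L * ‖z - x‖ ^ 2) (x v : E) :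
    F (x + v) ≤ F x + ⟪gradient F x, v⟫ + L / 2 * ‖v‖ ^ 2 := by
  have hderiv (s : ℝ) : HasDerivAt
      (fun s : ℝ => F (x + s • v) - s * ⟪gradient F x, v⟫ - L / 2 * s ^ 2 * ‖v‖ ^ 2)
      (⟪gradient F (x + s • v), v⟫ - ⟪gradient F x, v⟫ - L * s * ‖v‖ ^ 2) s := by
    have hline : HasDerivAt (fun s : ℝ => x + s • v) v s := by
      simpa using ((hasDerivAt_id s).smul_const v).const_add x
    have hcomp := (hF (x + s • v)).hasGradientAt.hasFDerivAt.comp_hasDerivAt s hline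
    have hlin := (hasDerivAt_id s).mul_const ⟪gradient F x, v⟫
    have hquad := (((hasDerivAt_id s).pow 2).const_mul (L / 2)).mul_const (‖v‖ ^ 2)
    refine ((hcomp.sub hlin).sub hquad).congr_deriv ?_
    rw [InnerProductSpace.toDual_apply_apply]
    simp only [id_eq]
    ring
  have hanti := antitoneOn_of_deriv_nonpos (convex_Icc (0 : ℝ) 1)
    (fun s _ => (hderiv s).continuousAt.continuousWithinAt)
    (fun s _ => (hderiv s).differentiableAt.differentiableWithinAt) (fun s hs => by
      rw [interior_Icc] at hs
      rw [(hderiv s).deriv]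
      have h := hL x (x + s • v)
      rw [add_sub_cancel_left, inner_smul_left, norm_smul, Real.norm_of_nonneg hs.1.le,
        real_inner_comm, inner_sub_left] at h
      simp only [conj_trivial] at h
      refine le_of_mul_le_mul_left ?_ hs.1
      linarith [h, mul_pow s ‖v‖ 2])
  have h := hanti (Set.left_mem_Icc.2 zero_le_one) (Set.right_mem_Icc.2 zero_le_one) zero_le_one
  simp only [one_smul, zero_smul, add_zero] at h
  linarith

/-- Strong monotonicity of the gradient gives a quadratic lower bound. -/
theorem quadratic_le_of_le_inner_gradient_sub {E : Type*} [NormedAddCommGroup E]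
    [InnerProductSpace ℝ E] [CompleteSpace E] {F : E → ℝ} (hF : Differentiable ℝ F) (m : ℝ)
    (hm : ∀ x z : E, m * ‖z - x‖ ^ 2 ≤ ⟪z - x, gradient F z - gradient F x⟫) (x v : E) :
    F x + ⟪gradient F x, v⟫ + m / 2 * ‖v‖ ^ 2 ≤ F (x + v) := by
  have hgrad (y : E) : gradient (fun z => -F z) y = -gradient F y := by
    simp [gradient]
  have h := le_quadratic_of_inner_gradient_sub_le hF.fun_neg (-m) (fun y z => by
    have := hm y z
    rw [hgrad, hgrad, ← neg_sub', inner_neg_right]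
    linarith) x v
  rw [hgrad, inner_neg_left] at h
  linarith

/-- The Polyak–Łojasiewicz inequality. -/
theorem two_mul_sub_le_norm_gradient_sq {E : Type*} [NormedAddCommGroup E]
    [InnerProductSpace ℝ E] [CompleteSpace E] {F : E → ℝ} (hF : Differentiable ℝ F) {m : ℝ}
    (hm : 0 < m)
    (hmono : ∀ x z : E, m * ‖z - x‖ ^ 2 ≤ ⟪z - x, gradient F z - gradient F x⟫) (x y : E) :
    2 * m * (F x - F y) ≤ ‖gradient F x‖ ^ 2 := by
  have h := quadratic_le_of_le_inner_gradient_sub hF m hmono x (y - x)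
  rw [add_sub_cancel] at h
  have hsq := sq_nonneg ‖gradient F x + m • (y - x)‖
  rw [norm_add_sq_real, inner_smul_right, norm_smul, Real.norm_of_nonneg hm.le] at hsq
  nlinarith [mul_le_mul_of_nonneg_left h hm.le]

/-- A gradient step with stepsize `α` contracts the suboptimality gap. -/
theorem gradient_step_sub_le {E : Type*} [NormedAddCommGroup E]
    [InnerProductSpace ℝ E] [CompleteSpace E] {F : E → ℝ} (hF : Differentiable ℝ F) {m M α : ℝ}
    (hm : 0 < m) (hα : 0 ≤ α) (hαM : 0 ≤ 1 - α * M / 2)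
    (hmono : ∀ x z : E, m * ‖z - x‖ ^ 2 ≤ ⟪z - x, gradient F z - gradient F x⟫)
    (hlip : ∀ x z : E, ⟪z - x, gradient F z - gradient F x⟫ ≤ M * ‖z - x‖ ^ 2) (x y : E) :
    F (x - α • gradient F x) - F y ≤ (1 - 2 * (1 - α * M / 2) * α * m) * (F x - F y) := by
  have hstep := le_quadratic_of_inner_gradient_sub_le hF M hlip x (-(α • gradient F x))
  rw [← sub_eq_add_neg, inner_neg_right, inner_smul_right, real_inner_self_eq_norm_sq, norm_neg,
    norm_smul, Real.norm_of_nonneg hα] at hstep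
  have hPL := mul_le_mul_of_nonneg_left (two_mul_sub_le_norm_gradient_sq hF hm hmono x y)
    (mul_nonneg hα hαM)
  linarith

/-- Moving by `-(δ * a / ‖v‖ ^ 2) • v`, where `v` is a perturbation of the gradient by `δ • h`,
increases the function by at most a term of second order in `δ`. -/
theorem perturbed_gradient_step_le {E : Type*} [NormedAddCommGroup E]
    [InnerProductSpace ℝ E] [CompleteSpace E] {F : E → ℝ} (hF : Differentiable ℝ F)
    {M K₁ K₂ δ ε a : ℝ} (hM : 0 ≤ M) (hδ : 0 ≤ δ) (hε : 0 < ε) (ha : 0 ≤ a) (haK : a ≤ K₁)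
    (hlip : ∀ x z : E, ⟪z - x, gradient F z - gradient F x⟫ ≤ M * ‖z - x‖ ^ 2) (x h v : E)
    (hh : ‖h‖ ≤ K₂) (hv : v = gradient F x + δ • h) (hεv : ε ≤ ‖v‖) :
    F (x - (δ * a / ‖v‖ ^ 2) • v) ≤
      F x + (M / (2 * ε ^ 2) * K₁ ^ 2 + 1 / ε * (K₁ * K₂)) * δ ^ 2 := by
  have hv0 : 0 < ‖v‖ := hε.trans_le hεv
  have hstep := le_quadratic_of_inner_gradient_sub_le hF M hlip x (-((δ * a / ‖v‖ ^ 2) • v))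
  have hg : gradient F x = v - δ • h := by rw [hv, add_sub_cancel_right]
  rw [← sub_eq_add_neg, inner_neg_right, inner_smul_right, norm_neg, norm_smul,
    Real.norm_of_nonneg (by positivity), hg, inner_sub_left, real_inner_self_eq_norm_sq,
    inner_smul_left] at hstep
  simp only [conj_trivial] at hstep
  have hcs : ⟪h, v⟫ ≤ K₂ * ‖v‖ :=
    (real_inner_le_norm h v).trans (mul_le_mul_of_nonneg_right hh hv0.le)
  have hK₁ : 0 ≤ K₁ := ha.trans haK
  have hK₂ : 0 ≤ K₂ := (norm_nonneg h).trans hh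
  have hlinear : -(δ * a / ‖v‖ ^ 2 * (‖v‖ ^ 2 - δ * ⟪h, v⟫)) ≤ 1 / ε * (K₁ * K₂) * δ ^ 2 := by
    calc -(δ * a / ‖v‖ ^ 2 * (‖v‖ ^ 2 - δ * ⟪h, v⟫))
        = δ ^ 2 * a / ‖v‖ ^ 2 * ⟪h, v⟫ - δ * a := by field_simp; ring
      _ ≤ δ ^ 2 * a / ‖v‖ ^ 2 * (K₂ * ‖v‖) - 0 := by gcongr; positivity
      _ = 1 / ‖v‖ * (a * K₂) * δ ^ 2 := by field_simp; ring
      _ ≤ 1 / ε * (K₁ * K₂) * δ ^ 2 := by gcongr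
  have hquad : M / 2 * (δ * a / ‖v‖ ^ 2 * ‖v‖) ^ 2 ≤ M / (2 * ε ^ 2) * K₁ ^ 2 * δ ^ 2 := by
    calc M / 2 * (δ * a / ‖v‖ ^ 2 * ‖v‖) ^ 2 = M / (2 * ‖v‖ ^ 2) * a ^ 2 * δ ^ 2 := by field_simp
      _ ≤ M / (2 * ε ^ 2) * K₁ ^ 2 * δ ^ 2 := by gcongr
  linarith

/-- An affine recursion `u (k + 1) ≤ c * (u k + B)` stays below the geometric interpolation between
`u 0` and any `E` with `c * B ≤ (1 - c) * E`. -/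
theorem le_geometric_of_le_mul_add {u : ℕ → ℝ} {c B E : ℝ} (hc : 0 ≤ c)
    (hBE : c * B ≤ (1 - c) * E) (hu : ∀ k, u (k + 1) ≤ c * (u k + B)) (k : ℕ) :
    u k ≤ c ^ k * u 0 + (1 - c ^ k) * E := by
  induction k with
  | zero => simp
  | succ k ih =>
    have h := mul_le_mul_of_nonneg_left ih hc
    rw [pow_succ]
    linarith [hu k]

/-- Theorem 3 (Convergence guarantee of Algorithm 3, which also uses `∇ₓₜf`). -/
theorem stmt_9 {n : ℕ} (hn : 1 ≤ n)
    (f : EuclideanSpace ℝ (Fin n) → ℝ → ℝ)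
    (m M K₁ K₂ K₃ : ℝ) (hm : 0 < m) (hM : 0 < M)
    (hK₁ : 0 < K₁) (hK₂ : 0 < K₂) (hK₃ : 0 < K₃)
    (hC2 : ContDiff ℝ 2 (Function.uncurry f))
    (hsc : ∀ t : ℝ, 0 ≤ t → ∀ x z : EuclideanSpace ℝ (Fin n), x ≠ z →
      m * ‖z - x‖ ^ 2 ≤ ⟪z - x, gradX f z t - gradX f x t⟫)
    (hlip : ∀ t : ℝ, 0 ≤ t → ∀ x z : EuclideanSpace ℝ (Fin n), x ≠ z →
      ⟪z - x, gradX f z t - gradX f x t⟫ ≤ M * ‖z - x‖ ^ 2)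
    (hb1 : ∀ (x : EuclideanSpace ℝ (Fin n)) (t : ℝ), 0 ≤ t → |gradT f x t| ≤ K₁)
    (hb2 : ∀ (x : EuclideanSpace ℝ (Fin n)) (t : ℝ), 0 ≤ t → ‖gradXT f x t‖ ≤ K₂)
    (hb3 : ∀ (x : EuclideanSpace ℝ (Fin n)) (t : ℝ), 0 ≤ t → |gradTT f x t| ≤ K₃)
    (xstar : ℝ → EuclideanSpace ℝ (Fin n))
    (hmin : ∀ t : ℝ, 0 ≤ t → ∀ y, f (xstar t) t ≤ f y t)
    (t0 δ ε α κ ψ γ μ η E₃ : ℝ) (ht0 : 0 ≤ t0) (hδ : 0 < δ) (hε : 0 < ε)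
    (hα : 0 < α) (hα2 : α ≤ 1 / (2 * M))
    (hκ : κ = 1 - α * M / 2)
    (hψ : ψ = δ * (K₁ + (δ / 2) * K₃) + (K₂ ^ 2 * δ ^ 2 / (2 * m)) * ((M * δ / m) + 2))
    (hγ : γ = 2 * K₁ / δ + (M / (2 * ε ^ 2)) * K₁ ^ 2 + (1 / 2) * K₃ + (1 / ε) * (K₁ * K₂))
    (hμ : μ = K₁ + (δ / 2) * K₃)
    (hη : η = 2 * K₁ / δ + (1 / 2) * K₃ + (2 / ε) * (K₁ * K₂) + (M / (2 * ε ^ 2)) * K₁ ^ 2)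
    (hE₃ : E₃ = ψ / (4 * κ ^ 2 * α ^ 2 * m) +
      max (γ * δ ^ 2) (max (μ * δ) (η * δ ^ 2)) / (4 * κ ^ 2 * α ^ 2 * m ^ 2))
    (x xm : ℕ → EuclideanSpace ℝ (Fin n))
    (hpred : ∀ k : ℕ, xm (k + 1) =
      if ε ≤ ‖gradX f (x k) (t0 + (k : ℝ) * δ) + δ • gradXT f (x k) (t0 + (k : ℝ) * δ)‖ ∧
          ⟪gradXT f (x k) (t0 + (k : ℝ) * δ), gradX f (x k) (t0 + (k : ℝ) * δ)⟫ ≤ 0 then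
        x k - (δ * |gradT f (x k) (t0 + (k : ℝ) * δ)| /
            ‖gradX f (x k) (t0 + (k : ℝ) * δ) + δ • gradXT f (x k) (t0 + (k : ℝ) * δ)‖ ^ 2) •
          (gradX f (x k) (t0 + (k : ℝ) * δ) + δ • gradXT f (x k) (t0 + (k : ℝ) * δ))
      else if ε ≤ ‖gradX f (x k) (t0 + (k : ℝ) * δ)‖ then
        x k - (δ * |gradT f (x k) (t0 + (k : ℝ) * δ)| /
          ‖gradX f (x k) (t0 + (k : ℝ) * δ)‖ ^ 2) • gradX f (x k) (t0 + (k : ℝ) * δ)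
      else x k)
    (hupd : ∀ k : ℕ, x (k + 1) = xm (k + 1) - α • gradX f (xm (k + 1)) (t0 + ((k : ℝ) + 1) * δ)) :
    ∀ k : ℕ, f (x k) (t0 + (k : ℝ) * δ) - f (xstar (t0 + (k : ℝ) * δ)) (t0 + (k : ℝ) * δ) ≤
      (1 - 2 * κ * α * m) ^ k * (f (x 0) t0 - f (xstar t0) t0) +
        (1 - (1 - 2 * κ * α * m) ^ k) * E₃ := by
  have hx (t : ℝ) : Differentiable ℝ (fun y => f y t) :=
    (hC2.differentiable (by norm_num)).comp (differentiable_id.prodMk (differentiable_const t))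
  have ht (y : EuclideanSpace ℝ (Fin n)) : Differentiable ℝ (fun s => f y s) :=
    (hC2.differentiable (by norm_num)).comp ((differentiable_const y).prodMk differentiable_id)
  have hmono (t : ℝ) (h0 : 0 ≤ t) (x z : EuclideanSpace ℝ (Fin n)) :
      m * ‖z - x‖ ^ 2 ≤ ⟪z - x, gradX f z t - gradX f x t⟫ := by
    rcases eq_or_ne x z with rfl | h
    · simp
    · exact hsc t h0 x z h
  have hup (t : ℝ) (h0 : 0 ≤ t) (x z : EuclideanSpace ℝ (Fin n)) :
      ⟪z - x, gradX f z t - gradX f x t⟫ ≤ M * ‖z - x‖ ^ 2 := by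
    rcases eq_or_ne x z with rfl | h
    · simp
    · exact hlip t h0 x z h
  have hmM : m ≤ M := by
    have : NeZero n := ⟨by omega⟩
    have h := (hmono 0 le_rfl 0 (EuclideanSpace.single 0 1)).trans
      (hup 0 le_rfl 0 (EuclideanSpace.single 0 1))
    simpa using h
  have htime (y : EuclideanSpace ℝ (Fin n)) (t : ℝ) (h0 : 0 ≤ t) :
      |f y (t + δ) - f y t| ≤ K₁ * δ := by
    have h := (convex_Ici (0 : ℝ)).norm_image_sub_le_of_norm_deriv_le (f := fun s => f y s)
      (fun s _ => ht y s) (fun s hs => hb1 y s hs) (Set.mem_Ici.2 h0)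
      (Set.mem_Ici.2 (add_nonneg h0 hδ.le))
    simpa [abs_of_pos hδ] using h
  have hαM : α * M ≤ 1 / 2 := by
    rw [le_div_iff₀ (by positivity)] at hα2
    linarith
  have hαm : α * m ≤ 1 / 2 := (mul_le_mul_of_nonneg_left hmM hα.le).trans hαM
  have hαM0 : 0 < α * M := mul_pos hα hM
  have hαm0 : 0 < α * m := mul_pos hα hm
  have hκ0 : 0 < κ := by linarith
  have hκ1 : κ ≤ 1 := by linarith
  have hc1 : 2 * κ * α * m ≤ 1 := by nlinarith
  have hr0 : 0 < 2 * κ * α * m := by positivity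
  have hψ0 : 0 ≤ ψ := by rw [hψ]; positivity
  have hγ0 : 0 ≤ γ := by rw [hγ]; positivity
  have hγδ : γ * δ ^ 2 =
      2 * K₁ * δ + 1 / 2 * K₃ * δ ^ 2 +
        (M / (2 * ε ^ 2) * K₁ ^ 2 + 1 / ε * (K₁ * K₂)) * δ ^ 2 := by
    rw [hγ]
    field_simp
    ring
  have hBE : (1 - 2 * κ * α * m) * (γ * δ ^ 2) ≤ (1 - (1 - 2 * κ * α * m)) * E₃ := by
    have hE : γ * δ ^ 2 / (2 * κ * α * m) ^ 2 ≤ E₃ := by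
      have hfirst : 0 ≤ ψ / (4 * κ ^ 2 * α ^ 2 * m) := by positivity
      have hsecond : γ * δ ^ 2 / (2 * κ * α * m) ^ 2 ≤
          max (γ * δ ^ 2) (max (μ * δ) (η * δ ^ 2)) / (4 * κ ^ 2 * α ^ 2 * m ^ 2) := by
        rw [show (2 * κ * α * m) ^ 2 = 4 * κ ^ 2 * α ^ 2 * m ^ 2 by ring]
        gcongr
        exact le_max_left _ _
      rw [hE₃]
      linarith
    have hB0 : 0 ≤ γ * δ ^ 2 := by positivity
    calc (1 - 2 * κ * α * m) * (γ * δ ^ 2) ≤ γ * δ ^ 2 := by nlinarith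
      _ ≤ γ * δ ^ 2 / (2 * κ * α * m) := le_div_self hB0 hr0 hc1
      _ = (1 - (1 - 2 * κ * α * m)) * (γ * δ ^ 2 / (2 * κ * α * m) ^ 2) := by field_simp; ring
      _ ≤ (1 - (1 - 2 * κ * α * m)) * E₃ := mul_le_mul_of_nonneg_left hE (by linarith)
  intro k
  have key := le_geometric_of_le_mul_add
    (u := fun k : ℕ => f (x k) (t0 + (k : ℝ) * δ) -
      f (xstar (t0 + (k : ℝ) * δ)) (t0 + (k : ℝ) * δ)) (sub_nonneg.2 hc1) hBE (fun k => ?_) k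
  · simpa using key
  have hpos : 0 ≤ t0 + (k : ℝ) * δ := by positivity
  have hp := hpred k
  have hnext : t0 + ((k : ℝ) + 1) * δ = t0 + (k : ℝ) * δ + δ := by ring
  simp only [Nat.cast_add, Nat.cast_one, hupd k, hnext]
  generalize t0 + (k : ℝ) * δ = t at hp hpos ⊢
  have hpos' : 0 ≤ t + δ := by positivity
  have hgrowth : f (xm (k + 1)) t ≤
      f (x k) t + (M / (2 * ε ^ 2) * K₁ ^ 2 + 1 / ε * (K₁ * K₂)) * δ ^ 2 := by
    rw [hp]
    split_ifs with h₁ h₂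
    · exact perturbed_gradient_step_le (hx t) hM.le hδ.le hε (abs_nonneg _) (hb1 _ _ hpos)
        (hup t hpos) (x k) (gradXT f (x k) t) _ (hb2 _ _ hpos) rfl h₁.1
    · exact perturbed_gradient_step_le (hx t) hM.le hδ.le hε (abs_nonneg _) (hb1 _ _ hpos)
        (hup t hpos) (x k) 0 _ (by simpa using hK₂.le) (by simp [gradX]) h₂
    · exact le_add_of_nonneg_right (by positivity)
  have hcontract := gradient_step_sub_le (hx (t + δ)) hm hα.le (hκ ▸ hκ0.le) (hmono _ hpos')
    (hup _ hpos') (xm (k + 1)) (xstar (t + δ))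
  rw [← hκ] at hcontract
  refine hcontract.trans (mul_le_mul_of_nonneg_left ?_ (sub_nonneg.2 hc1))
  have hK₃δ : 0 ≤ 1 / 2 * K₃ * δ ^ 2 := by positivity
  have hpred_time := (abs_le.1 (htime (xm (k + 1)) t hpos)).2
  have hstar_time := (abs_le.1 (htime (xstar (t + δ)) t hpos)).1
  linarith [hmin t hpos (xstar (t + δ))]
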